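/- Let U : ℝ → ℝ be C², with U(0) = 0, U'(0) = 0 and U''(0) = −1, such that U has exactly two other critical points u₋ < 0 < u₊ which are nondegenerate local minima. Suppose U'(u)² − 2U(u)U''(u) > 0 for all u ∈ (u₋, u₊) \ {0}. Then the period T(E) = 2∫_{u₂(E)}^{u₃(E)} du/√(E + U(u)) of the periodic orbit of u'' = U'(u) at energy E is strictly increasing on [0, E₀), where E₀ = −max(U(u₋), U(u₊)), and u₂(E) < 0 < u₃(E) are the two zeros of U(u) + E closest to 0. -/

import Mathlib

open Set Real

section HalfBranch

open MeasureTheory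

variable {V : ℝ → ℝ} {b : ℝ}

/-- The reciprocal of the derivative of `√V`. -/
noncomputable def invDerivSqrt (V : ℝ → ℝ) (u : ℝ) : ℝ := 2 * √(V u) / deriv V u

lemma contDiff_one_deriv (hV : ContDiff ℝ 2 V) : ContDiff ℝ 1 (deriv V) :=
  ((contDiff_succ_iff_deriv (n := 1)).1 (by norm_num; exact hV)).2.2

lemma exists_deriv_pos_deriv_sq_lt (hV : ContDiff ℝ 2 V) (hV0 : V 0 = 0)
    (hV'0 : deriv V 0 = 0) (hV''0 : deriv (deriv V) 0 = 1) :
    ∃ δ > 0, ∀ u ∈ Ioo 0 δ, 0 < deriv V u ∧ deriv V u ^ 2 < 4 * V u := by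
  have hd : Differentiable ℝ V := hV.differentiable (by norm_num)
  have hV1 := contDiff_one_deriv hV
  have hd' : Differentiable ℝ (deriv V) := hV1.differentiable (by norm_num)
  have hc : Continuous (deriv (deriv V)) := hV1.continuous_deriv (by norm_num)
  have hnhds : deriv (deriv V) ⁻¹' Ioo 0 2 ∈ nhds 0 :=
    hc.continuousAt.preimage_mem_nhds (by
      rw [hV''0]
      exact Ioo_mem_nhds (by norm_num) (by norm_num))
  obtain ⟨δ, hδ, hball⟩ := Metric.mem_nhds_iff.1 hnhds
  have hIoo : ∀ u ∈ Ioo 0 δ, deriv (deriv V) u ∈ Ioo 0 2 := fun u hu =>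
    hball (by simpa [Real.dist_eq, abs_of_pos hu.1] using hu.2)
  have hpos : ∀ u ∈ Ioo 0 δ, 0 < deriv V u := by
    have hmono : StrictMonoOn (deriv V) (Ico 0 δ) :=
      strictMonoOn_of_deriv_pos (convex_Ico _ _) hd'.continuous.continuousOn
        (by rw [interior_Ico]; exact fun u hu => (hIoo u hu).1)
    intro u hu
    simpa [hV'0] using hmono ⟨le_rfl, hδ⟩ ⟨hu.1.le, hu.2⟩ hu.1
  refine ⟨δ, hδ, fun u hu => ⟨hpos u hu, ?_⟩⟩
  have hG : ∀ x, HasDerivAt (fun x => 4 * V x - deriv V x ^ 2)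
      (4 * deriv V x - 2 * deriv V x * deriv (deriv V) x) x := fun x => by
    refine (((hd x).hasDerivAt.const_mul 4).fun_sub ((hd' x).hasDerivAt.fun_pow 2)).congr_deriv ?_
    simp
  have hmono : StrictMonoOn (fun x => 4 * V x - deriv V x ^ 2) (Ico 0 δ) := by
    refine strictMonoOn_of_deriv_pos (convex_Ico _ _)
      (fun x _ => (hG x).continuousAt.continuousWithinAt) ?_
    rw [interior_Ico]
    intro x hx
    rw [(hG x).deriv]
    nlinarith [mul_pos (hpos x hx) (sub_pos.2 (hIoo x hx).2)]
  have := hmono ⟨le_rfl, hδ⟩ ⟨hu.1.le, hu.2⟩ hu.1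
  simp only [hV0, hV'0] at this
  linarith

lemma deriv_pos_of_ne_zero (hV : ContDiff ℝ 2 V) (hV0 : V 0 = 0)
    (hV'0 : deriv V 0 = 0) (hV''0 : deriv (deriv V) 0 = 1)
    (hne : ∀ u ∈ Ioo 0 b, deriv V u ≠ 0) : ∀ u ∈ Ioo 0 b, 0 < deriv V u := by
  obtain ⟨δ, hδ, hδV⟩ := exists_deriv_pos_deriv_sq_lt hV hV0 hV'0 hV''0
  intro u hu
  by_contra hle
  have hm : 0 < min u (δ / 2) := lt_min hu.1 (by linarith)
  have hlt := (hδV (min u (δ / 2)) ⟨hm, by linarith [min_le_right u (δ / 2)]⟩).1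
  have hcont : Continuous (deriv V) := hV.continuous_deriv (by norm_num)
  obtain ⟨x, hx, hx0⟩ := intermediate_value_Icc' (min_le_left u (δ / 2)) hcont.continuousOn
    (show (0 : ℝ) ∈ Icc _ _ from ⟨not_lt.1 hle, hlt.le⟩)
  exact hne x ⟨hm.trans_le hx.1, hx.2.trans_lt hu.2⟩ hx0

lemma strictMonoOn_of_deriv_pos_Ioo (hV : ContDiff ℝ 2 V)
    (hpos : ∀ u ∈ Ioo 0 b, 0 < deriv V u) : StrictMonoOn V (Icc 0 b) :=
  strictMonoOn_of_deriv_pos (convex_Icc _ _) hV.continuous.continuousOn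
    (by rwa [interior_Icc])

lemma invDerivSqrt_strictMonoOn (hV : ContDiff ℝ 2 V) (hV0 : V 0 = 0)
    (hpos : ∀ u ∈ Ioo 0 b, 0 < deriv V u)
    (hcond : ∀ u ∈ Ioo 0 b, 0 < deriv V u ^ 2 - 2 * V u * deriv (deriv V) u) :
    StrictMonoOn (invDerivSqrt V) (Ioo 0 b) := by
  have hd : Differentiable ℝ V := hV.differentiable (by norm_num)
  have hV1 := contDiff_one_deriv hV
  have hd' : Differentiable ℝ (deriv V) := hV1.differentiable (by norm_num)
  have hVpos : ∀ u ∈ Ioo 0 b, 0 < V u := fun u hu => by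
    simpa [hV0] using strictMonoOn_of_deriv_pos_Ioo hV hpos
      ⟨le_rfl, (hu.1.trans hu.2).le⟩ ⟨hu.1.le, hu.2.le⟩ hu.1
  have hk : ∀ u ∈ Ioo 0 b, HasDerivAt (invDerivSqrt V)
      ((2 * (deriv V u / (2 * √(V u))) * deriv V u - 2 * √(V u) * deriv (deriv V) u)
        / deriv V u ^ 2) u := fun u hu =>
    (((hd u).hasDerivAt.sqrt (hVpos u hu).ne').const_mul 2).div (hd' u).hasDerivAt (hpos u hu).ne'
  refine strictMonoOn_of_deriv_pos (convex_Ioo _ _)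
    (fun u hu => (hk u hu).continuousAt.continuousWithinAt) ?_
  rw [interior_Ioo]
  intro u hu
  rw [(hk u hu).deriv]
  have hs : 0 < √(V u) := Real.sqrt_pos.2 (hVpos u hu)
  have hsq : √(V u) ^ 2 = V u := Real.sq_sqrt (hVpos u hu).le
  refine div_pos ?_ (pow_pos (hpos u hu) 2)
  have : 2 * (deriv V u / (2 * √(V u))) * deriv V u - 2 * √(V u) * deriv (deriv V) u
      = (deriv V u ^ 2 - 2 * √(V u) ^ 2 * deriv (deriv V) u) / √(V u) := by
    field_simp
  rw [this, hsq]
  exact div_pos (hcond u hu) hs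

lemma one_lt_invDerivSqrt (hV : ContDiff ℝ 2 V) (hV0 : V 0 = 0)
    (hV'0 : deriv V 0 = 0) (hV''0 : deriv (deriv V) 0 = 1)
    (hpos : ∀ u ∈ Ioo 0 b, 0 < deriv V u)
    (hcond : ∀ u ∈ Ioo 0 b, 0 < deriv V u ^ 2 - 2 * V u * deriv (deriv V) u) :
    ∀ u ∈ Ioo 0 b, 1 < invDerivSqrt V u := by
  obtain ⟨δ, hδ, hδV⟩ := exists_deriv_pos_deriv_sq_lt hV hV0 hV'0 hV''0
  intro u hu
  have hm : 0 < min u (δ / 2) := lt_min hu.1 (by linarith)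
  obtain ⟨h1, h2⟩ := hδV (min u (δ / 2)) ⟨hm, by linarith [min_le_right u (δ / 2)]⟩
  have hlt : 1 < invDerivSqrt V (min u (δ / 2)) := by
    rw [invDerivSqrt, lt_div_iff₀ h1, one_mul]
    refine lt_of_pow_lt_pow_left₀ 2 (by positivity) ?_
    rw [mul_pow, Real.sq_sqrt (by nlinarith)]
    linarith
  exact hlt.trans_le ((invDerivSqrt_strictMonoOn hV hV0 hpos hcond).monotoneOn
    ⟨hm, (min_le_left _ _).trans_lt hu.2⟩ hu (min_le_left _ _))

variable {M : ℝ} {a : ℝ → ℝ}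

lemma rightInverse_strictMonoOn (hmono : StrictMonoOn V (Icc 0 b))
    (ha : ∀ E ∈ Ioo 0 M, a E ∈ Ioo 0 b ∧ V (a E) = E) : StrictMonoOn a (Ioo 0 M) := by
  intro E hE F hF hlt
  rw [← hmono.lt_iff_lt (Ioo_subset_Icc_self (ha E hE).1) (Ioo_subset_Icc_self (ha F hF).1),
    (ha E hE).2, (ha F hF).2]
  exact hlt

lemma mul_sin_sq_mem_Ioo {E θ : ℝ} (hE : 0 < E) (hθ : θ ∈ Ioo 0 (π / 2)) :
    E * sin θ ^ 2 ∈ Ioo 0 E := by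
  have h1 : 0 < sin θ := sin_pos_of_pos_of_lt_pi hθ.1 (by linarith [hθ.2, pi_pos])
  have h2 : 0 < cos θ := cos_pos_of_mem_Ioo ⟨by linarith [hθ.1, pi_pos], hθ.2⟩
  refine ⟨by positivity, ?_⟩
  nlinarith [sin_sq_add_cos_sq θ, mul_pos hE (pow_pos h2 2)]

/-- The half-period integrand in the angle variable is integrable, because it is monotone. -/
lemma integrableOn_angle (hk : MonotoneOn (invDerivSqrt V) (Ioo 0 b))
    (hk1 : ∀ u ∈ Ioo 0 b, 1 < invDerivSqrt V u)
    (hamono : StrictMonoOn a (Ioo 0 M)) (ha : ∀ E ∈ Ioo 0 M, a E ∈ Ioo 0 b)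
    {E : ℝ} (hE : E ∈ Ioo 0 M) :
    IntegrableOn (fun θ => invDerivSqrt V (a (E * sin θ ^ 2))) (Ioo 0 (π / 2)) := by
  have hmem : ∀ θ ∈ Ioo 0 (π / 2), E * sin θ ^ 2 ∈ Ioo 0 M := fun θ hθ =>
    ⟨(mul_sin_sq_mem_Ioo hE.1 hθ).1, (mul_sin_sq_mem_Ioo hE.1 hθ).2.trans hE.2⟩
  have hmono : MonotoneOn (fun θ => invDerivSqrt V (a (E * sin θ ^ 2))) (Ioo 0 (π / 2)) := by
    intro x hx y hy hxy
    refine hk (ha _ (hmem x hx)) (ha _ (hmem y hy))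
      (hamono.monotoneOn (hmem x hx) (hmem y hy) ?_)
    have h1 : 0 < sin x := sin_pos_of_pos_of_lt_pi hx.1 (by linarith [hx.2, pi_pos])
    have h2 : sin x ≤ sin y :=
      sin_le_sin_of_le_of_le_pi_div_two (by linarith [hx.1, pi_pos]) hy.2.le hxy
    have := hE.1.le
    gcongr
  refine Integrable.of_bound
    (aemeasurable_restrict_of_monotoneOn measurableSet_Ioo hmono).aestronglyMeasurable
    (invDerivSqrt V (a E)) ?_
  filter_upwards [ae_restrict_mem measurableSet_Ioo] with θ hθ
  rw [Real.norm_of_nonneg (by linarith [hk1 _ (ha _ (hmem θ hθ))])]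
  exact hk (ha _ (hmem θ hθ)) (ha _ hE)
    (hamono.monotoneOn (hmem θ hθ) hE (mul_sin_sq_mem_Ioo hE.1 hθ).2.le)

/-- The substitution `V u = E sin² θ` in the half-period integral. -/
lemma halfPeriod_change_of_variables (hV : ContDiff ℝ 2 V) (hV0 : V 0 = 0)
    (hpos : ∀ u ∈ Ioo 0 b, 0 < deriv V u)
    (ha : ∀ E ∈ Ioo 0 M, a E ∈ Ioo 0 b ∧ V (a E) = E) {E : ℝ} (hE : E ∈ Ioo 0 M) :
    (IntegrableOn (fun θ => invDerivSqrt V (a (E * sin θ ^ 2))) (Ioo 0 (π / 2)) ↔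
      IntegrableOn (fun u => 1 / √(E - V u)) (Ioo 0 (a E))) ∧
    ∫ θ in Ioo 0 (π / 2), invDerivSqrt V (a (E * sin θ ^ 2)) =
      ∫ u in Ioo 0 (a E), 1 / √(E - V u) := by
  have hd : Differentiable ℝ V := hV.differentiable (by norm_num)
  have hmono := strictMonoOn_of_deriv_pos_Ioo hV hpos
  have hamono := rightInverse_strictMonoOn hmono ha
  obtain ⟨haE, hVaE⟩ := ha E hE
  have hE0 := hE.1
  have hb : ∀ u ∈ Ioo 0 (a E), u ∈ Ioo 0 b := fun u hu => ⟨hu.1, hu.2.trans haE.2⟩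
  have hVu : ∀ u ∈ Ioo 0 (a E), V u ∈ Ioo 0 E := fun u hu => by
    have h1 := hmono ⟨le_rfl, (hu.1.trans (hb u hu).2).le⟩ (Ioo_subset_Icc_self (hb u hu)) hu.1
    have h2 := hmono (Ioo_subset_Icc_self (hb u hu)) (Ioo_subset_Icc_self haE) hu.2
    exact ⟨by rwa [hV0] at h1, by rwa [hVaE] at h2⟩
  have hinv : ∀ u ∈ Ioo 0 (a E), a (V u) = u := fun u hu => by
    have hm : V u ∈ Ioo 0 M := ⟨(hVu u hu).1, (hVu u hu).2.trans hE.2⟩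
    exact hmono.injOn (Ioo_subset_Icc_self (ha _ hm).1) (Ioo_subset_Icc_self (hb u hu))
      (ha _ hm).2
  set f : ℝ → ℝ := fun u => arcsin (√(V u) / √E) with hf
  have hratio : ∀ u ∈ Ioo 0 (a E), √(V u) / √E ∈ Ioo 0 1 := fun u hu =>
    ⟨div_pos (Real.sqrt_pos.2 (hVu u hu).1) (Real.sqrt_pos.2 hE0),
      (div_lt_one (Real.sqrt_pos.2 hE0)).2 (Real.sqrt_lt_sqrt (hVu u hu).1.le (hVu u hu).2)⟩
  have hsin : ∀ u ∈ Ioo 0 (a E), E * sin (f u) ^ 2 = V u := fun u hu => by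
    rw [hf, sin_arcsin (by linarith [(hratio u hu).1]) (hratio u hu).2.le, div_pow,
      Real.sq_sqrt hE0.le, Real.sq_sqrt (hVu u hu).1.le]
    field_simp
  have hinj : InjOn f (Ioo 0 (a E)) := fun x hx y hy hxy => by
    rw [← hinv x hx, ← hinv y hy, ← hsin x hx, ← hsin y hy, hxy]
  have himage : f '' Ioo 0 (a E) = Ioo 0 (π / 2) := by
    ext θ
    constructor
    · rintro ⟨u, hu, rfl⟩
      exact ⟨arcsin_pos.2 (hratio u hu).1, arcsin_lt_pi_div_two.2 (hratio u hu).2⟩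
    · intro hθ
      have hm := mul_sin_sq_mem_Ioo hE0 hθ
      have hmM : E * sin θ ^ 2 ∈ Ioo 0 M := ⟨hm.1, hm.2.trans hE.2⟩
      have hs : 0 < sin θ := sin_pos_of_pos_of_lt_pi hθ.1 (by linarith [hθ.2, pi_pos])
      refine ⟨a (E * sin θ ^ 2), ⟨(ha _ hmM).1.1, hamono hmM hE hm.2⟩, ?_⟩
      rw [hf]
      dsimp only
      rw [(ha _ hmM).2, Real.sqrt_mul hE0.le, Real.sqrt_sq hs.le,
        mul_div_cancel_left₀ _ (Real.sqrt_pos.2 hE0).ne',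
        arcsin_sin (by linarith [hθ.1, pi_pos]) hθ.2.le]
  have hderiv : ∀ u ∈ Ioo 0 (a E), HasDerivWithinAt f
      (deriv V u / (2 * √(V u) * √(E - V u))) (Ioo 0 (a E)) u := fun u hu => by
    have hr := hratio u hu
    have h := (hasDerivAt_arcsin (by linarith [hr.1]) hr.2.ne).comp u
      (((hd u).hasDerivAt.sqrt (hVu u hu).1.ne').div_const (√E))
    refine (h.congr_deriv ?_).hasDerivWithinAt
    have h1 : 1 - (√(V u) / √E) ^ 2 = (E - V u) / E := by
      rw [div_pow, Real.sq_sqrt hE0.le, Real.sq_sqrt (hVu u hu).1.le]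
      field_simp
    rw [h1, Real.sqrt_div (by linarith [(hVu u hu).2])]
    have h2 := Real.sqrt_pos.2 hE0
    have h3 := Real.sqrt_pos.2 (hVu u hu).1
    have h4 := Real.sqrt_pos.2 (sub_pos.2 (hVu u hu).2)
    field_simp
  have heq : ∀ u ∈ Ioo 0 (a E), |deriv V u / (2 * √(V u) * √(E - V u))| •
      invDerivSqrt V (a (E * sin (f u) ^ 2)) = 1 / √(E - V u) := fun u hu => by
    have h3 := Real.sqrt_pos.2 (hVu u hu).1
    have h4 := Real.sqrt_pos.2 (sub_pos.2 (hVu u hu).2)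
    have h5 := hpos u (hb u hu)
    rw [hsin u hu, hinv u hu, abs_of_pos (by positivity), invDerivSqrt, smul_eq_mul]
    field_simp
  constructor
  · rw [← himage, integrableOn_image_iff_integrableOn_abs_deriv_smul measurableSet_Ioo hderiv hinj]
    exact integrableOn_congr_fun heq measurableSet_Ioo
  · rw [← himage, integral_image_eq_integral_abs_deriv_smul measurableSet_Ioo hderiv hinj]
    exact setIntegral_congr_fun measurableSet_Ioo heq

lemma setIntegral_angle_lt {f g : ℝ → ℝ} (hf : IntegrableOn f (Ioo 0 (π / 2)))
    (hg : IntegrableOn g (Ioo 0 (π / 2))) (h : ∀ θ ∈ Ioo 0 (π / 2), f θ < g θ) :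
    ∫ θ in Ioo 0 (π / 2), f θ < ∫ θ in Ioo 0 (π / 2), g θ := by
  have hi : IntegrableOn (fun θ => g θ - f θ) (Ioo 0 (π / 2)) := hg.sub hf
  have hpos : 0 < ∫ θ in Ioo 0 (π / 2), (g θ - f θ) := by
    rw [← integral_Ioc_eq_integral_Ioo, ← intervalIntegral.integral_of_le (by positivity)]
    refine intervalIntegral.intervalIntegral_pos_of_pos_on ?_
      (fun θ hθ => sub_pos.2 (h θ hθ)) (by positivity)
    rwa [intervalIntegrable_iff_integrableOn_Ioo_of_le (by positivity)]
  rw [integral_sub hg hf] at hpos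
  linarith

/-- Integrability, strict monotonicity in the energy and a lower bound for the integral
over one of the two halves of the potential well. -/
theorem halfPeriod_properties (hV : ContDiff ℝ 2 V) (hV0 : V 0 = 0)
    (hV'0 : deriv V 0 = 0) (hV''0 : deriv (deriv V) 0 = 1)
    (hne : ∀ u ∈ Ioo 0 b, deriv V u ≠ 0)
    (hcond : ∀ u ∈ Ioo 0 b, 0 < deriv V u ^ 2 - 2 * V u * deriv (deriv V) u)
    (ha : ∀ E ∈ Ioo 0 M, a E ∈ Ioo 0 b ∧ V (a E) = E) :
    (∀ E ∈ Ioo 0 M, IntervalIntegrable (fun u => 1 / √(E - V u)) volume 0 (a E)) ∧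
    StrictMonoOn (fun E => ∫ u in (0)..(a E), 1 / √(E - V u)) (Ioo 0 M) ∧
    ∀ E ∈ Ioo 0 M, π / 2 < ∫ u in (0)..(a E), 1 / √(E - V u) := by
  have hpos := deriv_pos_of_ne_zero hV hV0 hV'0 hV''0 hne
  have hk := invDerivSqrt_strictMonoOn hV hV0 hpos hcond
  have hk1 := one_lt_invDerivSqrt hV hV0 hV'0 hV''0 hpos hcond
  have hamono := rightInverse_strictMonoOn (strictMonoOn_of_deriv_pos_Ioo hV hpos) ha
  have haIoo : ∀ E ∈ Ioo 0 M, a E ∈ Ioo 0 b := fun E hE => (ha E hE).1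
  have hint : ∀ E ∈ Ioo 0 M, IntegrableOn
      (fun θ => invDerivSqrt V (a (E * sin θ ^ 2))) (Ioo 0 (π / 2)) := fun E hE =>
    integrableOn_angle hk.monotoneOn hk1 hamono haIoo hE
  have hcov := fun E hE => halfPeriod_change_of_variables hV hV0 hpos ha (E := E) hE
  have heq : ∀ E ∈ Ioo 0 M, ∫ u in (0)..(a E), 1 / √(E - V u) =
      ∫ θ in Ioo 0 (π / 2), invDerivSqrt V (a (E * sin θ ^ 2)) := fun E hE => by
    rw [intervalIntegral.integral_of_le (haIoo E hE).1.le, integral_Ioc_eq_integral_Ioo,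
      (hcov E hE).2]
  have hmem : ∀ E ∈ Ioo 0 M, ∀ θ ∈ Ioo 0 (π / 2), E * sin θ ^ 2 ∈ Ioo 0 M := fun E hE θ hθ =>
    ⟨(mul_sin_sq_mem_Ioo hE.1 hθ).1, (mul_sin_sq_mem_Ioo hE.1 hθ).2.trans hE.2⟩
  refine ⟨fun E hE => ?_, fun E hE F hF hlt => ?_, fun E hE => ?_⟩
  · rw [intervalIntegrable_iff_integrableOn_Ioo_of_le (haIoo E hE).1.le]
    exact (hcov E hE).1.1 (hint E hE)
  · dsimp only
    rw [heq E hE, heq F hF]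
    refine setIntegral_angle_lt (hint E hE) (hint F hF) fun θ hθ => ?_
    have hs : 0 < sin θ := sin_pos_of_pos_of_lt_pi hθ.1 (by linarith [hθ.2, pi_pos])
    exact hk (haIoo _ (hmem E hE θ hθ)) (haIoo _ (hmem F hF θ hθ))
      (hamono (hmem E hE θ hθ) (hmem F hF θ hθ) (by gcongr))
  · rw [heq E hE]
    have hone := setIntegral_angle_lt (f := fun _ => 1) (by simp) (hint E hE)
      fun θ hθ => hk1 _ (haIoo _ (hmem E hE θ hθ))
    simp only [setIntegral_const, smul_eq_mul, mul_one, volume_real_Ioo_of_le pi_div_two_pos.le,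
      sub_zero] at hone
    exact hone

end HalfBranch

/-- Monotonicity of the period of the Hamiltonian system `u'' = U'(u)`:
if `U'(u)² − 2 U(u) U''(u) > 0` on `(u₋, u₊) \ {0}`, then the period
`T(E) = 2 ∫_{u₂(E)}^{u₃(E)} du/√(E + U(u))` is strictly increasing on `[0, E₀)`. -/
theorem period_strictMono
    (U : ℝ → ℝ) (hU : ContDiff ℝ 2 U)
    (hU0 : U 0 = 0) (hU'0 : deriv U 0 = 0) (hU''0 : deriv (deriv U) 0 = -1)
    (um up : ℝ) (hum : um < 0) (hup : 0 < up)
    (hcrit : ∀ u : ℝ, deriv U u = 0 ↔ u = um ∨ u = 0 ∨ u = up)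
    (hminm : 0 < deriv (deriv U) um) (hminp : 0 < deriv (deriv U) up)
    (hcond : ∀ u ∈ Set.Ioo um up, u ≠ 0 →
      0 < (deriv U u) ^ 2 - 2 * U u * deriv (deriv U) u)
    (E₀ : ℝ) (hE₀ : E₀ = -(max (U um) (U up)))
    (u₂ u₃ : ℝ → ℝ)
    (hu₂ : ∀ E ∈ Set.Ioo 0 E₀, u₂ E ∈ Set.Ioo um 0 ∧ U (u₂ E) = -E)
    (hu₃ : ∀ E ∈ Set.Ioo 0 E₀, u₃ E ∈ Set.Ioo 0 up ∧ U (u₃ E) = -E)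
    (hu₂uniq : ∀ E ∈ Set.Ioo 0 E₀, ∀ u ∈ Set.Ioo um 0, U u = -E → u = u₂ E)
    (hu₃uniq : ∀ E ∈ Set.Ioo 0 E₀, ∀ u ∈ Set.Ioo 0 up, U u = -E → u = u₃ E)
    (T : ℝ → ℝ)
    (hT : ∀ E ∈ Set.Ioo 0 E₀,
      T E = 2 * ∫ u in (u₂ E)..(u₃ E), 1 / Real.sqrt (E + U u))
    (hT0 : T 0 = 2 * Real.pi) :
    StrictMonoOn T (Set.Ico 0 E₀) := by
  have hright := halfPeriod_properties (V := fun u => -U u) (b := up) (M := E₀) (a := u₃)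
    hU.neg (by simp [hU0]) (by simp [hU'0]) (by simp [hU''0])
    (fun u hu h => by
      rw [deriv.fun_neg, neg_eq_zero, hcrit] at h
      rcases h with h | h | h <;> linarith [hu.1, hu.2])
    (fun u hu => by
      have := hcond u ⟨hum.trans hu.1, hu.2⟩ hu.1.ne'
      simp only [deriv.fun_neg']
      linarith)
    (fun E hE => ⟨(hu₃ E hE).1, by simp [(hu₃ E hE).2]⟩)
  have hd1 : deriv (fun u => -U (-u)) = fun u => deriv U (-u) := by
    ext u
    rw [deriv.fun_neg, deriv_comp_neg, neg_neg]
  have hd2 : ∀ u, deriv (fun u => deriv U (-u)) u = -deriv (deriv U) (-u) := fun u =>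
    deriv_comp_neg _ _
  have hleft := halfPeriod_properties (V := fun u => -U (-u)) (b := -um) (M := E₀)
    (a := fun E => -u₂ E)
    (hU.comp contDiff_neg).neg (by simp [hU0]) (by simp [hd1, hU'0]) (by simp [hd1, hd2, hU''0])
    (fun u hu h => by
      rw [hd1, hcrit] at h
      rcases h with h | h | h <;> linarith [hu.1, hu.2])
    (fun u hu => by
      have := hcond (-u) ⟨by linarith [hu.2], by linarith [hu.1]⟩ (by linarith [hu.1] : -u < 0).ne
      simp only [hd1, hd2]
      linarith)
    (fun E hE => ⟨⟨by linarith [(hu₂ E hE).1.2], by linarith [(hu₂ E hE).1.1]⟩,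
      by simp [(hu₂ E hE).2]⟩)
  simp only [sub_neg_eq_add] at hright hleft
  obtain ⟨hri, hrm, hrl⟩ := hright
  obtain ⟨hli, hlm, hll⟩ := hleft
  have hsplit : ∀ E ∈ Set.Ioo 0 E₀, T E = 2 * ((∫ u in (0)..(-u₂ E), 1 / √(E + U (-u))) +
      ∫ u in (0)..(u₃ E), 1 / √(E + U u)) := by
    intro E hE
    have hi : IntervalIntegrable (fun u => 1 / √(E + U u)) MeasureTheory.volume (u₂ E) 0 := by
      have := (IntervalIntegrable.iff_comp_neg).1 (hli E hE)
      simpa using this.symm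
    rw [hT E hE, ← intervalIntegral.integral_add_adjacent_intervals hi (hri E hE),
      intervalIntegral.integral_comp_neg (fun u => 1 / √(E + U u)), neg_neg, neg_zero]
  intro E hE F hF hlt
  have hF' : F ∈ Set.Ioo 0 E₀ := ⟨hE.1.trans_lt hlt, hF.2⟩
  rw [hsplit F hF']
  rcases hE.1.eq_or_lt with rfl | hE0
  · rw [hT0]
    linarith [hll F hF', hrl F hF']
  · have hE' : E ∈ Set.Ioo 0 E₀ := ⟨hE0, hE.2⟩
    rw [hsplit E hE']
    have h1 := hlm hE' hF' hlt
    have h2 := hrm hE' hF' hlt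
    dsimp only at h1 h2
    linarith
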